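/- Suppose μ₂ > 0 and λ₂ > μ₂. Then for every j ∈ ℕ the limit p_j := lim_{t→∞} P(d(V_t) = j) exists; moreover p_0 = (μ₂λ₁/(λ₂(λ₂−μ₂)))·B(2, λ₁/(λ₂−μ₂))·₂F₁(1, λ₁/(λ₂−μ₂), 2 + λ₁/(λ₂−μ₂), μ₂/λ₂) and, for every j ≥ 1, p_j = (λ₁(λ₂−μ₂)/λ₂²)·B(j, 1 + λ₁/(λ₂−μ₂))·₂F₁(j+1, 1 + λ₁/(λ₂−μ₂), j+1+λ₁/(λ₂−μ₂), μ₂/λ₂). -/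

import Mathlib

open Filter Topology MeasureTheory

/-- The Beta function `B(a,b) = ∫₀¹ s^(a-1) (1-s)^(b-1) ds`. -/
noncomputable def betaFn (a b : ℝ) : ℝ :=
  ∫ s in (0:ℝ)..1, s ^ (a - 1) * (1 - s) ^ (b - 1)

/-- The Gauss hypergeometric function
`₂F₁(a,b,c,z) = (1/B(b,c-b)) ∫₀¹ s^(b-1) (1-s)^(c-b-1) (1-sz)^(-a) ds`. -/
noncomputable def gauss2F1 (a b c z : ℝ) : ℝ :=
  (betaFn b (c - b))⁻¹ * ∫ s in (0:ℝ)..1, s ^ (b - 1) * (1 - s) ^ (c - b - 1) * (1 - s * z) ^ (-a)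

/-- The confluent hypergeometric function
`U(a,b,z) = (1/Γ(a)) ∫₀^∞ e^(-zs) s^(a-1) (1+s)^(b-a-1) ds`. -/
noncomputable def hypU (a b z : ℝ) : ℝ :=
  (Real.Gamma a)⁻¹ * ∫ s in Set.Ioi (0:ℝ), Real.exp (-z * s) * s ^ (a - 1) * (1 + s) ^ (b - a - 1)

/-- One-step transition probability of the preferential attachment–detachment
in-degree chain on nonempty finite sequences of naturals (encoded as lists):
from a state `x`, the `i`-th entry is increased by `1` with probability
`xⁱλ₂ / ((λ₂+μ₂)‖x‖ + ℓ(x)λ₁)`, decreased by `1` with probability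
`xⁱμ₂ / ((λ₂+μ₂)‖x‖ + ℓ(x)λ₁)`, and an entry `1` is appended with probability
`ℓ(x)λ₁ / ((λ₂+μ₂)‖x‖ + ℓ(x)λ₁)`. -/
noncomputable def stepProb (lam1 lam2 mu2 : ℝ) (x y : List ℕ) : ℝ :=
  ((∑ i ∈ Finset.range x.length,
      (x.getD i 0 : ℝ) * lam2 * (if y = x.set i (x.getD i 0 + 1) then 1 else 0)) +
   (∑ i ∈ Finset.range x.length,
      (x.getD i 0 : ℝ) * mu2 * (if y = x.set i (x.getD i 0 - 1) then 1 else 0)) +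
   (x.length : ℝ) * lam1 * (if y = x ++ [1] then 1 else 0)) /
    ((lam2 + mu2) * (x.sum : ℝ) + (x.length : ℝ) * lam1)

/-- Distribution at time `t` of the Markov chain `d = (d_t)` started at the
length-one sequence `(1)`. -/
noncomputable def chainDist (lam1 lam2 mu2 : ℝ) : ℕ → List ℕ → ℝ
  | 0 => fun x => if x = [1] then 1 else 0
  | (t + 1) => fun y => ∑' x : List ℕ, chainDist lam1 lam2 mu2 t x * stepProb lam1 lam2 mu2 x y

/-- `P(d(V_t) = j)`, the in-degree distribution of a vertex chosen uniformly at
random at time `t`, i.e. the expectation of `ℓ(d_t)⁻¹ ∑ᵢ 1{d_tⁱ = j}`. -/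
noncomputable def inDegProb (lam1 lam2 mu2 : ℝ) (t j : ℕ) : ℝ :=
  ∑' x : List ℕ, chainDist lam1 lam2 mu2 t x * ((x.count j : ℝ) / (x.length : ℝ))

section Chain

variable {lam1 lam2 mu2 : ℝ}

/-- The transition operator of the in-degree chain acting on functions of the state. -/
noncomputable def stepOp (lam1 lam2 mu2 : ℝ) (f : List ℕ → ℝ) (x : List ℕ) : ℝ :=
  ((∑ i ∈ Finset.range x.length, (x.getD i 0 : ℝ) * lam2 * f (x.set i (x.getD i 0 + 1))) +
   (∑ i ∈ Finset.range x.length, (x.getD i 0 : ℝ) * mu2 * f (x.set i (x.getD i 0 - 1))) +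
   (x.length : ℝ) * lam1 * f (x ++ [1])) /
    ((lam2 + mu2) * (x.sum : ℝ) + (x.length : ℝ) * lam1)

/-- The expectation of `f` under the law of the chain at time `t`. -/
noncomputable def chainExp (lam1 lam2 mu2 : ℝ) : ℕ → (List ℕ → ℝ) → ℝ
  | 0 => fun f => f [1]
  | (t + 1) => fun f => chainExp lam1 lam2 mu2 t (stepOp lam1 lam2 mu2 f)

theorem hasSum_stepOp {ι : Type*} {F : ι → List ℕ → ℝ} {f : List ℕ → ℝ}
    (hF : ∀ x, HasSum (fun k => F k x) (f x)) (x : List ℕ) :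
    HasSum (fun k => stepOp lam1 lam2 mu2 (F k) x) (stepOp lam1 lam2 mu2 f x) := by
  unfold stepOp
  exact (((hasSum_sum fun i _ => (hF _).mul_left _).add
    (hasSum_sum fun i _ => (hF _).mul_left _)).add ((hF _).mul_left _)).div_const _

theorem hasSum_chainExp {ι : Type*} (t : ℕ) {F : ι → List ℕ → ℝ} {f : List ℕ → ℝ}
    (hF : ∀ x, HasSum (fun k => F k x) (f x)) :
    HasSum (fun k => chainExp lam1 lam2 mu2 t (F k)) (chainExp lam1 lam2 mu2 t f) := by
  induction t generalizing F f with
  | zero => exact hF _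
  | succ t ih => exact ih (hasSum_stepOp hF)

theorem stepOp_add (f g : List ℕ → ℝ) :
    stepOp lam1 lam2 mu2 (fun x => f x + g x) =
      fun x => stepOp lam1 lam2 mu2 f x + stepOp lam1 lam2 mu2 g x := by
  funext x
  simp only [stepOp, mul_add, Finset.sum_add_distrib]
  ring

theorem stepOp_const_mul (c : ℝ) (f : List ℕ → ℝ) :
    stepOp lam1 lam2 mu2 (fun x => c * f x) = fun x => c * stepOp lam1 lam2 mu2 f x := by
  funext x
  simp only [stepOp, mul_left_comm _ c, ← Finset.mul_sum]
  ring

theorem chainExp_add (t : ℕ) (f g : List ℕ → ℝ) :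
    chainExp lam1 lam2 mu2 t (fun x => f x + g x) =
      chainExp lam1 lam2 mu2 t f + chainExp lam1 lam2 mu2 t g := by
  induction t generalizing f g with
  | zero => rfl
  | succ t ih => simp only [chainExp, stepOp_add, ih]

theorem chainExp_const_mul (t : ℕ) (c : ℝ) (f : List ℕ → ℝ) :
    chainExp lam1 lam2 mu2 t (fun x => c * f x) = c * chainExp lam1 lam2 mu2 t f := by
  induction t generalizing f with
  | zero => rfl
  | succ t ih => simp only [chainExp, stepOp_const_mul, ih]

theorem chainDist_eq_chainExp (t : ℕ) (y : List ℕ) :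
    chainDist lam1 lam2 mu2 t y = chainExp lam1 lam2 mu2 t (fun v => if y = v then 1 else 0) ∧
    ∀ f : List ℕ → ℝ, ∑' x, chainDist lam1 lam2 mu2 t x * f x = chainExp lam1 lam2 mu2 t f := by
  have expand : ∀ t, (∀ y, chainDist lam1 lam2 mu2 t y =
      chainExp lam1 lam2 mu2 t (fun v => if y = v then 1 else 0)) →
      ∀ f : List ℕ → ℝ,
        ∑' x, chainDist lam1 lam2 mu2 t x * f x = chainExp lam1 lam2 mu2 t f := by
    intro t ht f
    refine HasSum.tsum_eq ?_
    have := hasSum_chainExp (lam1 := lam1) (lam2 := lam2) (mu2 := mu2) t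
      (F := fun y v => f y * (if y = v then 1 else 0)) (f := f) fun x => by
        simpa using hasSum_single (f := fun y => f y * (if y = x then 1 else 0)) x
          fun y hy => by simp [hy]
    simpa only [chainExp_const_mul, ← ht, mul_comm] using this
  have point : ∀ y, chainDist lam1 lam2 mu2 t y =
      chainExp lam1 lam2 mu2 t (fun v => if y = v then 1 else 0) := by
    induction t with
    | zero => intro y; rfl
    | succ t ih => intro y; exact expand t ih _
  exact ⟨point y, expand t point⟩

theorem tsum_chainDist_mul (t : ℕ) (f : List ℕ → ℝ) :
    ∑' x, chainDist lam1 lam2 mu2 t x * f x = chainExp lam1 lam2 mu2 t f :=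
  (chainDist_eq_chainExp t []).2 f

/-- A superset of the states that the chain can occupy at time `t`. -/
def IsReachable (t : ℕ) (x : List ℕ) : Prop :=
  x ≠ [] ∧ x.sum + x.length ≤ 2 * (t + 1)

theorem sum_set_add_getD (x : List ℕ) (i a : ℕ) (hi : i < x.length) :
    (x.set i a).sum + x.getD i 0 = x.sum + a := by
  induction x generalizing i with
  | nil => simp at hi
  | cons b x ih =>
    cases i with
    | zero => simp; omega
    | succ i =>
      have := ih i (by simpa using hi)
      simp only [List.set_cons_succ, List.sum_cons, List.getD_cons_succ]
      omega

theorem IsReachable.set_succ {t : ℕ} {x : List ℕ} (hx : IsReachable t x) {i : ℕ}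
    (hi : i < x.length) : IsReachable (t + 1) (x.set i (x.getD i 0 + 1)) := by
  have := sum_set_add_getD x i (x.getD i 0 + 1) hi
  refine ⟨by simpa using hx.1, ?_⟩
  have := hx.2
  rw [List.length_set]
  omega

theorem IsReachable.set_pred {t : ℕ} {x : List ℕ} (hx : IsReachable t x) {i : ℕ}
    (hi : i < x.length) : IsReachable (t + 1) (x.set i (x.getD i 0 - 1)) := by
  have := sum_set_add_getD x i (x.getD i 0 - 1) hi
  refine ⟨by simpa using hx.1, ?_⟩
  have := hx.2
  rw [List.length_set]
  omega

theorem IsReachable.append_one {t : ℕ} {x : List ℕ} (hx : IsReachable t x) :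
    IsReachable (t + 1) (x ++ [1]) := by
  have := hx.2
  refine ⟨by simp, ?_⟩
  simp
  omega

theorem chainExp_mono (hlam1 : 0 ≤ lam1) (hlam2 : 0 ≤ lam2) (hmu2 : 0 ≤ mu2) (t : ℕ)
    {f g : List ℕ → ℝ} (hfg : ∀ x, IsReachable t x → f x ≤ g x) :
    chainExp lam1 lam2 mu2 t f ≤ chainExp lam1 lam2 mu2 t g := by
  induction t generalizing f g with
  | zero => exact hfg _ ⟨by simp, by simp⟩
  | succ t ih =>
    refine ih fun x hx => ?_
    unfold stepOp
    gcongr with i hi i hi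
    · exact hfg _ (hx.set_succ (Finset.mem_range.1 hi))
    · exact hfg _ (hx.set_pred (Finset.mem_range.1 hi))
    · exact hfg _ hx.append_one

theorem sum_range_getD (x : List ℕ) (ψ : ℕ → ℝ) :
    ∑ i ∈ Finset.range x.length, ψ (x.getD i 0) = (x.map ψ).sum := by
  induction x with
  | nil => simp
  | cons a x ih =>
    rw [List.length_cons, Finset.sum_range_succ']
    simp only [List.getD_cons_succ, List.getD_cons_zero, ih, List.map_cons, List.sum_cons]
    ring

theorem sum_range_getD_cast (x : List ℕ) :
    ∑ i ∈ Finset.range x.length, (x.getD i 0 : ℝ) = (x.sum : ℝ) := by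
  rw [sum_range_getD x (fun n => (n : ℝ)), Nat.cast_list_sum]

theorem totalRate_pos (hlam1 : 0 < lam1) (hlam2 : 0 ≤ lam2) (hmu2 : 0 ≤ mu2) {x : List ℕ}
    (hx : x ≠ []) : 0 < (lam2 + mu2) * (x.sum : ℝ) + (x.length : ℝ) * lam1 := by
  have : 0 < (x.length : ℝ) := by exact_mod_cast List.length_pos_of_ne_nil hx
  positivity

/-- The transition operator in terms of the generator of the continuous-time chain. -/
theorem stepOp_eq_add_div (hlam1 : 0 < lam1) (hlam2 : 0 ≤ lam2) (hmu2 : 0 ≤ mu2)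
    (f : List ℕ → ℝ) {x : List ℕ} (hx : x ≠ []) :
    stepOp lam1 lam2 mu2 f x = f x +
      ((∑ i ∈ Finset.range x.length,
          (x.getD i 0 : ℝ) * lam2 * (f (x.set i (x.getD i 0 + 1)) - f x)) +
        (∑ i ∈ Finset.range x.length,
          (x.getD i 0 : ℝ) * mu2 * (f (x.set i (x.getD i 0 - 1)) - f x)) +
        (x.length : ℝ) * lam1 * (f (x ++ [1]) - f x)) /
      ((lam2 + mu2) * (x.sum : ℝ) + (x.length : ℝ) * lam1) := by
  have hW := (totalRate_pos hlam1 hlam2 hmu2 hx).ne'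
  rw [eq_comm, add_div' _ _ _ hW]
  unfold stepOp
  congr 1
  simp only [mul_sub, Finset.sum_sub_distrib, ← Finset.sum_mul, sum_range_getD_cast]
  ring

theorem chainExp_const (hlam1 : 0 < lam1) (hlam2 : 0 ≤ lam2) (hmu2 : 0 ≤ mu2) (t : ℕ) (c : ℝ) :
    chainExp lam1 lam2 mu2 t (fun _ => c) = c := by
  induction t with
  | zero => rfl
  | succ t ih =>
    have key : ∀ x, IsReachable t x → stepOp lam1 lam2 mu2 (fun _ => c) x = c := fun x hx => by
      rw [stepOp_eq_add_div hlam1 hlam2 hmu2 _ hx.1]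
      simp
    exact (le_antisymm (chainExp_mono hlam1.le hlam2 hmu2 t fun x hx => (key x hx).le)
      (chainExp_mono hlam1.le hlam2 hmu2 t fun x hx => (key x hx).ge)).trans ih

theorem sq_chainExp_le (hlam1 : 0 < lam1) (hlam2 : 0 ≤ lam2) (hmu2 : 0 ≤ mu2) (t : ℕ)
    (f : List ℕ → ℝ) :
    chainExp lam1 lam2 mu2 t f ^ 2 ≤ chainExp lam1 lam2 mu2 t (fun x => f x ^ 2) := by
  set c := chainExp lam1 lam2 mu2 t f with hc
  have hpos : chainExp lam1 lam2 mu2 t (fun _ => (0 : ℝ)) ≤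
      chainExp lam1 lam2 mu2 t (fun x => f x ^ 2 + ((-2 * c) * f x + c ^ 2)) :=
    chainExp_mono hlam1.le hlam2 hmu2 t fun x _ => by nlinarith [sq_nonneg (f x - c)]
  rw [chainExp_const hlam1 hlam2 hmu2, chainExp_add, chainExp_add, chainExp_const_mul,
    chainExp_const hlam1 hlam2 hmu2, ← hc] at hpos
  nlinarith

end Chain

section Average

variable {lam1 lam2 mu2 : ℝ}

/-- The average of `φ` over the entries of a state. -/
noncomputable def entryAvg (φ : ℕ → ℝ) (x : List ℕ) : ℝ :=
  (x.map φ).sum / x.length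

theorem sum_map_set (φ : ℕ → ℝ) (x : List ℕ) (i a : ℕ) (hi : i < x.length) :
    ((x.set i a).map φ).sum = (x.map φ).sum + (φ a - φ (x.getD i 0)) := by
  induction x generalizing i with
  | nil => simp at hi
  | cons b x ih =>
    cases i with
    | zero => simp; ring
    | succ i =>
      simp only [List.set_cons_succ, List.map_cons, List.sum_cons, List.getD_cons_succ,
        ih i (by simpa using hi)]
      ring

theorem entryAvg_set (φ : ℕ → ℝ) (x : List ℕ) (i a : ℕ) (hi : i < x.length) :
    entryAvg φ (x.set i a) = entryAvg φ x + (φ a - φ (x.getD i 0)) / x.length := by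
  rw [entryAvg, sum_map_set φ x i a hi, List.length_set, add_div, entryAvg]

theorem entryAvg_append_one (φ : ℕ → ℝ) {x : List ℕ} (hx : x ≠ []) :
    entryAvg φ (x ++ [1]) = entryAvg φ x + (φ 1 - entryAvg φ x) / (x.length + 1) := by
  have : 0 < (x.length : ℝ) := by exact_mod_cast List.length_pos_of_ne_nil hx
  simp only [entryAvg, List.map_append, List.map_cons, List.map_nil, List.sum_append,
    List.sum_cons, List.sum_nil, List.length_append, List.length_cons, List.length_nil]
  push_cast
  field_simp
  ring

theorem sum_map_le (φ : ℕ → ℝ) {K : ℝ} (hφ : ∀ n, φ n ≤ K) (x : List ℕ) :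
    (x.map φ).sum ≤ x.length * K := by
  induction x with
  | nil => simp
  | cons a x ih =>
    simp only [List.map_cons, List.sum_cons, List.length_cons]
    push_cast
    linarith [hφ a]

theorem entryAvg_le (φ : ℕ → ℝ) {M : ℝ} (hφ : ∀ n, φ n ≤ M) {x : List ℕ} (hx : x ≠ []) :
    entryAvg φ x ≤ M := by
  have : 0 < (x.length : ℝ) := by exact_mod_cast List.length_pos_of_ne_nil hx
  rw [entryAvg, div_le_iff₀ this, mul_comm]
  exact sum_map_le φ hφ x

theorem abs_entryAvg_le (φ : ℕ → ℝ) {M : ℝ} (hφ : ∀ n, |φ n| ≤ M) {x : List ℕ} (hx : x ≠ []) :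
    |entryAvg φ x| ≤ M := by
  refine abs_le.2 ⟨?_, entryAvg_le φ (fun n => (abs_le.1 (hφ n)).2) hx⟩
  have := entryAvg_le (fun n => -φ n) (fun n => neg_le.1 (abs_le.1 (hφ n)).1) hx
  have h : entryAvg (fun n => -φ n) x = -entryAvg φ x := by
    simp only [entryAvg, ← sum_range_getD, Finset.sum_neg_distrib, neg_div]
  linarith

theorem hasSum_entryAvg {ι : Type*} {F : ι → ℕ → ℝ} {f : ℕ → ℝ}
    (hF : ∀ n, HasSum (fun k => F k n) (f n)) (x : List ℕ) :
    HasSum (fun k => entryAvg (F k) x) (entryAvg f x) := by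
  unfold entryAvg
  simp only [← sum_range_getD]
  exact (hasSum_sum fun i _ => hF _).div_const _

theorem entryAvg_const_mul (c : ℝ) (φ : ℕ → ℝ) (x : List ℕ) :
    entryAvg (fun n => c * φ n) x = c * entryAvg φ x := by
  simp only [entryAvg, List.sum_map_mul_left, mul_div_assoc]

theorem entryAvg_indicator (j : ℕ) (x : List ℕ) :
    entryAvg (fun n => if n = j then 1 else 0) x = (x.count j : ℝ) / x.length := by
  unfold entryAvg
  congr 1
  induction x with
  | nil => simp
  | cons a x ih =>
    rw [List.map_cons, List.sum_cons, ih, List.count_cons]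
    split_ifs <;> simp_all [add_comm]

theorem inDegProb_eq_chainExp (t j : ℕ) :
    inDegProb lam1 lam2 mu2 t j =
      chainExp lam1 lam2 mu2 t (entryAvg fun n => if n = j then 1 else 0) := by
  rw [inDegProb, tsum_chainDist_mul]
  congr 1
  funext x
  rw [entryAvg_indicator]

/-- The squared deviation of an average from its limit, made a strict Lyapunov function by a
multiple of the inverse length. -/
noncomputable def lyapunov (φ : ℕ → ℝ) (m K : ℝ) (x : List ℕ) : ℝ :=
  (entryAvg φ x - m) ^ 2 + K / x.length

theorem append_drift_le {lam1 κ M K Y D L A m p : ℝ} (hlam1 : 0 < lam1) (hκ : 0 ≤ κ)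
    (hL : 1 ≤ L) (hK : 0 ≤ K)
    (hY : Y = A - m) (hD : D = p - A) (hm : (κ + lam1) * m = lam1 * p)
    (hYM : |Y| ≤ 2 * M) (hDM : |D| ≤ 2 * M) :
    2 * Y * (-κ * A) + K / L + L * lam1 * (2 * Y * (D / (L + 1)) + (D / (L + 1)) ^ 2 +
      (4 * (K + 12 * lam1 * M ^ 2) / lam1) * (1 / (L + 1) - 1 / L)) ≤
    -(lam1 / 4 * (Y ^ 2 + (4 * (K + 12 * lam1 * M ^ 2) / lam1) / L)) := by
  have hL0 : 0 < L := by linarith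
  have e1 : 2 * Y * (-κ * A) + L * lam1 * (2 * Y * (D / (L + 1))) =
      -2 * (κ + lam1) * Y ^ 2 - 2 * lam1 * (Y * D) / (L + 1) := by
    field_simp
    subst hY hD
    linear_combination (-(A - m) * (L + 1)) * hm
  have hYD : |Y * D| ≤ 4 * M ^ 2 := by
    rw [abs_mul]
    nlinarith [abs_nonneg Y, abs_nonneg D]
  have hD2 : D ^ 2 ≤ 4 * M ^ 2 := by
    rw [← sq_abs]
    nlinarith [abs_nonneg D]
  have e2 : -(2 * lam1 * (Y * D) / (L + 1)) ≤ 8 * lam1 * M ^ 2 / L := by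
    rw [← neg_div, div_le_div_iff₀ (by linarith) hL0]
    have := neg_le_of_abs_le hYD
    nlinarith [mul_pos hlam1 hL0, mul_nonneg hlam1.le (sq_nonneg M)]
  have e3 : L * lam1 * (D / (L + 1)) ^ 2 ≤ 4 * lam1 * M ^ 2 / L := by
    rw [div_pow, mul_div_assoc', div_le_div_iff₀ (by positivity) hL0]
    have h1 : L * lam1 * D ^ 2 * L ≤ L * lam1 * (4 * M ^ 2) * L := by gcongr
    have h2 : L ^ 2 * (lam1 * (4 * M ^ 2)) ≤ (L + 1) ^ 2 * (lam1 * (4 * M ^ 2)) := by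
      gcongr
      linarith
    linarith
  have e4 : L * lam1 * ((4 * (K + 12 * lam1 * M ^ 2) / lam1) * (1 / (L + 1) - 1 / L)) ≤
      -(2 * (K + 12 * lam1 * M ^ 2) / L) := by
    have : L * lam1 * ((4 * (K + 12 * lam1 * M ^ 2) / lam1) * (1 / (L + 1) - 1 / L)) =
        -(4 * (K + 12 * lam1 * M ^ 2) / (L + 1)) := by
      field_simp
      ring
    rw [this, neg_le_neg_iff, div_le_div_iff₀ hL0 (by linarith)]
    nlinarith [mul_nonneg hlam1.le (sq_nonneg M), mul_nonneg hL0.le hK,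
      mul_nonneg hL0.le (mul_nonneg hlam1.le (sq_nonneg M))]
  have e5 : lam1 / 4 * (Y ^ 2 + (4 * (K + 12 * lam1 * M ^ 2) / lam1) / L) =
      lam1 / 4 * Y ^ 2 + (K / L + 8 * lam1 * M ^ 2 / L + 4 * lam1 * M ^ 2 / L) := by
    field_simp
    ring
  have e6 : 2 * (K + 12 * lam1 * M ^ 2) / L =
      2 * (K / L + 8 * lam1 * M ^ 2 / L + 4 * lam1 * M ^ 2 / L) := by
    field_simp
    ring
  have e7 : 0 ≤ κ * Y ^ 2 := by positivity
  have e8 : 0 ≤ lam1 * Y ^ 2 := by positivity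
  rw [e5]
  rw [e6] at e4
  linarith

theorem stepOp_lyapunov_le (hlam1 : 0 < lam1) (hlam2 : 0 ≤ lam2) (hmu2 : 0 ≤ mu2)
    {φ : ℕ → ℝ} {κ M K m : ℝ} (hκ : 0 ≤ κ) (hφ : ∀ n, |φ n| ≤ M)
    (heig : ∀ n : ℕ, n * lam2 * (φ (n + 1) - φ n) + n * mu2 * (φ (n - 1) - φ n) = -κ * φ n)
    (hvar : ∀ n : ℕ, n * lam2 * (φ (n + 1) - φ n) ^ 2 + n * mu2 * (φ (n - 1) - φ n) ^ 2 ≤ K)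
    (hm : (κ + lam1) * m = lam1 * φ 1) {x : List ℕ} (hx : x ≠ []) :
    stepOp lam1 lam2 mu2 (lyapunov φ m (4 * (K + 12 * lam1 * M ^ 2) / lam1)) x ≤
      lyapunov φ m (4 * (K + 12 * lam1 * M ^ 2) / lam1) x *
        (1 - lam1 / 4 / ((lam2 + mu2) * (x.sum : ℝ) + (x.length : ℝ) * lam1)) := by
  have hW := totalRate_pos hlam1 hlam2 hmu2 hx
  have hL : 1 ≤ (x.length : ℝ) := by exact_mod_cast List.length_pos_of_ne_nil hx
  have hL0 : 0 < (x.length : ℝ) := by linarith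
  have hK : 0 ≤ K := by simpa using hvar 0
  have hA := abs_entryAvg_le φ hφ hx
  have hM : 0 ≤ M := (abs_nonneg _).trans (hφ 0)
  have hmM : |m| ≤ M := by
    have h1 : |(κ + lam1) * m| = |lam1 * φ 1| := by rw [hm]
    rw [abs_mul, abs_mul, abs_of_pos hlam1, abs_of_pos (by linarith)] at h1
    have h2 := hφ 1
    nlinarith [abs_nonneg m]
  rw [stepOp_eq_add_div hlam1 hlam2 hmu2 _ hx, mul_one_sub, sub_eq_add_neg (lyapunov _ _ _ x),
    add_le_add_iff_left, ← mul_div_assoc, ← neg_div, div_le_div_iff_of_pos_right hW]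
  set C := 4 * (K + 12 * lam1 * M ^ 2) / lam1 with hC
  set A := entryAvg φ x with hAdef
  set L := (x.length : ℝ) with hLdef
  have hsucc : ∀ i ∈ Finset.range x.length,
      (x.getD i 0 : ℝ) * lam2 *
        (lyapunov φ m C (x.set i (x.getD i 0 + 1)) - lyapunov φ m C x) =
      2 * (A - m) / L * ((x.getD i 0 : ℝ) * lam2 * (φ (x.getD i 0 + 1) - φ (x.getD i 0))) +
      1 / L ^ 2 * ((x.getD i 0 : ℝ) * lam2 * (φ (x.getD i 0 + 1) - φ (x.getD i 0)) ^ 2) := by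
    intro i hi
    rw [lyapunov, lyapunov, entryAvg_set φ x i _ (Finset.mem_range.1 hi), List.length_set,
      ← hAdef, ← hLdef]
    field_simp
    ring
  have hpred : ∀ i ∈ Finset.range x.length,
      (x.getD i 0 : ℝ) * mu2 *
        (lyapunov φ m C (x.set i (x.getD i 0 - 1)) - lyapunov φ m C x) =
      2 * (A - m) / L * ((x.getD i 0 : ℝ) * mu2 * (φ (x.getD i 0 - 1) - φ (x.getD i 0))) +
      1 / L ^ 2 * ((x.getD i 0 : ℝ) * mu2 * (φ (x.getD i 0 - 1) - φ (x.getD i 0)) ^ 2) := by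
    intro i hi
    rw [lyapunov, lyapunov, entryAvg_set φ x i _ (Finset.mem_range.1 hi), List.length_set,
      ← hAdef, ← hLdef]
    field_simp
    ring
  rw [Finset.sum_congr rfl hsucc, Finset.sum_congr rfl hpred, ← Finset.sum_add_distrib]
  have hcomb : ∀ i ∈ Finset.range x.length,
      (2 * (A - m) / L * ((x.getD i 0 : ℝ) * lam2 * (φ (x.getD i 0 + 1) - φ (x.getD i 0))) +
      1 / L ^ 2 * ((x.getD i 0 : ℝ) * lam2 * (φ (x.getD i 0 + 1) - φ (x.getD i 0)) ^ 2)) +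
      (2 * (A - m) / L * ((x.getD i 0 : ℝ) * mu2 * (φ (x.getD i 0 - 1) - φ (x.getD i 0))) +
      1 / L ^ 2 * ((x.getD i 0 : ℝ) * mu2 * (φ (x.getD i 0 - 1) - φ (x.getD i 0)) ^ 2)) ≤
      2 * (A - m) / L * (-κ * φ (x.getD i 0)) + 1 / L ^ 2 * K := by
    intro i _
    rw [← heig]
    have := mul_le_mul_of_nonneg_left (hvar (x.getD i 0)) (by positivity : 0 ≤ 1 / L ^ 2)
    linarith
  have hsum := Finset.sum_le_sum hcomb
  have hrhs : ∑ i ∈ Finset.range x.length,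
      (2 * (A - m) / L * (-κ * φ (x.getD i 0)) + 1 / L ^ 2 * K) =
      2 * (A - m) / L * (-κ * (x.map φ).sum) + L * (1 / L ^ 2 * K) := by
    rw [Finset.sum_add_distrib, ← Finset.mul_sum, ← Finset.mul_sum, sum_range_getD,
      Finset.sum_const, Finset.card_range, nsmul_eq_mul, ← hLdef]
  have hS : (x.map φ).sum = L * A := by
    rw [hAdef, entryAvg, mul_div_cancel₀ _ hL0.ne']
  have happ : lyapunov φ m C (x ++ [1]) - lyapunov φ m C x =
      2 * (A - m) * ((φ 1 - A) / (L + 1)) + ((φ 1 - A) / (L + 1)) ^ 2 +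
        C * (1 / (L + 1) - 1 / L) := by
    rw [lyapunov, lyapunov, entryAvg_append_one φ hx, List.length_append, ← hAdef]
    push_cast
    rw [← hLdef]
    simp only [List.length_cons, List.length_nil]
    push_cast
    ring
  have hmain := append_drift_le (K := K) (A := A) hlam1 hκ hL hK rfl rfl hm
    (M := M) ((abs_sub _ _).trans (by linarith)) ((abs_sub _ _).trans (by linarith [hφ 1]))
  have hfin : 2 * (A - m) / L * (-κ * (x.map φ).sum) + L * (1 / L ^ 2 * K) =
      2 * (A - m) * (-κ * A) + K / L := by
    rw [hS]
    field_simp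
  rw [hrhs, hfin] at hsum
  rw [happ, lyapunov, ← hAdef, ← hLdef, mul_comm _ (lam1 / 4)]
  rw [← hC] at hmain
  linarith

theorem tendsto_zero_of_le_mul_one_sub {v : ℕ → ℝ} {δ : ℝ} (hδ : 0 < δ) (hv : ∀ t, 0 ≤ v t)
    (hstep : ∀ t : ℕ, v (t + 1) ≤ v t * (1 - δ / ((t : ℝ) + 1))) :
    Tendsto v atTop (𝓝 0) := by
  have bound : ∀ t, v t ≤ v 0 * Real.exp (-(δ * ∑ i ∈ Finset.range t, 1 / ((i : ℝ) + 1))) := by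
    intro t
    induction t with
    | zero => simp
    | succ t ih =>
      calc v (t + 1) ≤ v t * (1 - δ / ((t : ℝ) + 1)) := hstep t
        _ ≤ v t * Real.exp (-(δ / ((t : ℝ) + 1))) := by
          gcongr
          · exact hv t
          · linarith [Real.add_one_le_exp (-(δ / ((t : ℝ) + 1)))]
        _ ≤ _ := by
          refine (mul_le_mul_of_nonneg_right ih (Real.exp_pos _).le).trans_eq ?_
          rw [Finset.sum_range_succ, mul_assoc, ← Real.exp_add]
          congr 2
          ring
  refine squeeze_zero hv bound ?_
  rw [← mul_zero (v 0)]
  refine Tendsto.const_mul _ (Real.tendsto_exp_neg_atTop_nhds_zero.comp ?_)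
  exact Real.tendsto_sum_range_one_div_nat_succ_atTop.const_mul_atTop hδ

theorem tendsto_chainExp_entryAvg (hlam1 : 0 < lam1) (hlam2 : 0 ≤ lam2) (hmu2 : 0 ≤ mu2)
    {φ : ℕ → ℝ} {κ M K : ℝ} (hκ : 0 ≤ κ) (hφ : ∀ n, |φ n| ≤ M)
    (heig : ∀ n : ℕ, n * lam2 * (φ (n + 1) - φ n) + n * mu2 * (φ (n - 1) - φ n) = -κ * φ n)
    (hvar : ∀ n : ℕ, n * lam2 * (φ (n + 1) - φ n) ^ 2 + n * mu2 * (φ (n - 1) - φ n) ^ 2 ≤ K) :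
    Tendsto (fun t => chainExp lam1 lam2 mu2 t (entryAvg φ)) atTop
      (𝓝 (lam1 * φ 1 / (κ + lam1))) := by
  set m := lam1 * φ 1 / (κ + lam1) with hmdef
  have hm : (κ + lam1) * m = lam1 * φ 1 := by rw [hmdef]; field_simp
  set C := 4 * (K + 12 * lam1 * M ^ 2) / lam1 with hC
  have hK : 0 ≤ K := by simpa using hvar 0
  have hC0 : 0 ≤ C := by positivity
  have hV0 : ∀ x, 0 ≤ lyapunov φ m C x := fun x => by unfold lyapunov; positivity
  have hlyap : Tendsto (fun t => chainExp lam1 lam2 mu2 t (lyapunov φ m C)) atTop (𝓝 0) := by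
    refine tendsto_zero_of_le_mul_one_sub
      (δ := lam1 / 4 / (2 * (lam2 + mu2 + lam1))) (by positivity) (fun t => ?_) fun t => ?_
    · have := chainExp_mono hlam1.le hlam2 hmu2 t fun x _ => hV0 x
      rwa [chainExp_const hlam1 hlam2 hmu2] at this
    · rw [mul_comm, ← chainExp_const_mul]
      refine chainExp_mono hlam1.le hlam2 hmu2 t fun x hx => ?_
      refine (stepOp_lyapunov_le hlam1 hlam2 hmu2 hκ hφ heig hvar hm hx.1).trans ?_
      rw [mul_comm]
      have hW := totalRate_pos hlam1 hlam2 hmu2 hx.1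
      have hsz : (x.sum : ℝ) + x.length ≤ 2 * ((t : ℝ) + 1) := by exact_mod_cast hx.2
      refine mul_le_mul_of_nonneg_right ?_ (hV0 x)
      rw [div_div _ (2 * _)]
      refine sub_le_sub_left (div_le_div_of_nonneg_left (by positivity) hW ?_) 1
      nlinarith [Nat.cast_nonneg (α := ℝ) x.sum, Nat.cast_nonneg (α := ℝ) x.length,
        mul_nonneg hlam2 (Nat.cast_nonneg (α := ℝ) x.length),
        mul_nonneg hmu2 (Nat.cast_nonneg (α := ℝ) x.length),
        mul_nonneg hlam1.le (Nat.cast_nonneg (α := ℝ) x.sum),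
        mul_le_mul_of_nonneg_left hsz (by positivity : 0 ≤ lam2 + mu2 + lam1)]
  have hsq : Tendsto (fun t => (chainExp lam1 lam2 mu2 t (entryAvg φ) - m) ^ 2) atTop (𝓝 0) := by
    refine squeeze_zero (fun t => sq_nonneg _) (fun t => ?_) hlyap
    have h1 := sq_chainExp_le hlam1 hlam2 hmu2 t (fun x => entryAvg φ x + -m)
    rw [chainExp_add, chainExp_const hlam1 hlam2 hmu2] at h1
    refine h1.trans (chainExp_mono hlam1.le hlam2 hmu2 t fun x _ => ?_)
    simp only [lyapunov, ← sub_eq_add_neg]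
    have : 0 ≤ C / (x.length : ℝ) := by positivity
    linarith
  have habs := hsq.sqrt
  simp only [Real.sqrt_sq_eq_abs, Real.sqrt_zero] at habs
  exact tendsto_sub_nhds_zero_iff.1 ((tendsto_zero_iff_abs_tendsto_zero _).2 habs)

end Average

section Eigenfunction

open PowerSeries

variable {lam mu : ℝ}

/-- The Taylor series at `0` of `w ↦ (mu - w) / (lam - w)`. -/
noncomputable def moebiusSeries (lam mu : ℝ) : PowerSeries ℝ :=
  1 - C ((lam - mu) / lam) * PowerSeries.mk fun k => lam⁻¹ ^ k

/-- The `k`-th Taylor coefficient of `w ↦ ((mu - w) / (lam - w)) ^ n`. As a function of `n` it is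
an eigenfunction of the linear birth-death generator, with eigenvalue `-(lam - mu) * k`. -/
noncomputable def birthDeathEigenfun (lam mu : ℝ) (k n : ℕ) : ℝ :=
  coeff k (moebiusSeries lam mu ^ n)

theorem moebiusSeries_mul (hlam : lam ≠ 0) :
    moebiusSeries lam mu * (C lam - X) = C mu - X := by
  have hgeom : (PowerSeries.mk fun k => lam⁻¹ ^ k) * (C lam - X) = C lam := by
    ext k
    cases k with
    | zero => simp [mul_sub]
    | succ k =>
      rw [mul_sub, map_sub, coeff_succ_mul_X, coeff_mul_C, coeff_mk, coeff_mk, coeff_C]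
      simp [pow_succ, hlam]
  rw [moebiusSeries, sub_mul, one_mul, mul_assoc, hgeom, ← map_mul, div_mul_cancel₀ _ hlam,
    map_sub]
  ring

theorem moebiusSeries_ode (hlam : lam ≠ 0) :
    (C lam * moebiusSeries lam mu - C mu) * (moebiusSeries lam mu - 1) =
      C (-(lam - mu)) * X * d⁄dX ℝ (moebiusSeries lam mu) := by
  set Z := moebiusSeries lam mu with hZ
  have h1 : Z * (C lam - X) = C mu - X := moebiusSeries_mul hlam
  have h2 : d⁄dX ℝ Z * (C lam - X) = Z - 1 := by
    have := congrArg (d⁄dX ℝ) h1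
    simp only [Derivation.leibniz, map_sub, derivative_C, derivative_X, smul_eq_mul] at this
    linear_combination this
  have h3 : (C lam - X : PowerSeries ℝ) ≠ 0 := fun h => hlam (by simpa using congrArg (coeff 0) h)
  refine mul_right_cancel₀ h3 ?_
  rw [map_neg, map_sub]
  linear_combination (C lam * (Z - 1)) * h1 - (C mu - C lam) * X * h2

theorem birthDeathEigenfun_eigen (hlam : lam ≠ 0) (k n : ℕ) :
    n * lam * (birthDeathEigenfun lam mu k (n + 1) - birthDeathEigenfun lam mu k n) +
      n * mu * (birthDeathEigenfun lam mu k (n - 1) - birthDeathEigenfun lam mu k n) =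
      -((lam - mu) * k) * birthDeathEigenfun lam mu k n := by
  set Z := moebiusSeries lam mu with hZ
  have key : C (n * lam) * (Z ^ (n + 1) - Z ^ n) + C (n * mu) * (Z ^ (n - 1) - Z ^ n) =
      C (-(lam - mu)) * (X * d⁄dX ℝ (Z ^ n)) := by
    rcases n with _ | n
    · simp
    · have h := moebiusSeries_ode (mu := mu) hlam
      rw [← hZ] at h
      rw [derivative_pow, Nat.add_sub_cancel, map_mul, map_mul, map_natCast]
      linear_combination ((n + 1 : ℕ) : PowerSeries ℝ) * Z ^ n * h
  have hX : coeff k (X * d⁄dX ℝ (Z ^ n)) = k * coeff k (Z ^ n) := by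
    cases k with
    | zero => simp
    | succ k =>
      rw [coeff_succ_X_mul, coeff_derivative]
      push_cast
      ring
  have := congrArg (coeff k) key
  simp only [map_add, map_sub, coeff_C_mul, hX] at this
  unfold birthDeathEigenfun
  rw [← hZ, this]
  ring

theorem hasSum_coeff_mul {f g : PowerSeries ℝ} {w a b : ℂ}
    (hf : Summable fun k => ‖((coeff k f : ℝ) : ℂ) * w ^ k‖)
    (hfa : HasSum (fun k => ((coeff k f : ℝ) : ℂ) * w ^ k) a)
    (hg : Summable fun k => ‖((coeff k g : ℝ) : ℂ) * w ^ k‖)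
    (hgb : HasSum (fun k => ((coeff k g : ℝ) : ℂ) * w ^ k) b) :
    (Summable fun k => ‖((coeff k (f * g) : ℝ) : ℂ) * w ^ k‖) ∧
      HasSum (fun k => ((coeff k (f * g) : ℝ) : ℂ) * w ^ k) (a * b) := by
  have hterm : ∀ k, ((coeff k (f * g) : ℝ) : ℂ) * w ^ k =
      ∑ p ∈ Finset.HasAntidiagonal.antidiagonal k, (((coeff p.1 f : ℝ) : ℂ) * w ^ p.1) *
        (((coeff p.2 g : ℝ) : ℂ) * w ^ p.2) := by
    intro k
    rw [coeff_mul, Complex.ofReal_sum, Finset.sum_mul]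
    refine Finset.sum_congr rfl fun p hp => ?_
    rw [← Finset.HasAntidiagonal.mem_antidiagonal.1 hp, pow_add, Complex.ofReal_mul]
    ring
  have hsum := summable_norm_sum_mul_antidiagonal_of_summable_norm hf hg
  have htsum := tsum_mul_tsum_eq_tsum_sum_antidiagonal_of_summable_norm hf hg
  simp only [← hterm] at hsum htsum
  rw [hfa.tsum_eq, hgb.tsum_eq] at htsum
  exact ⟨hsum, htsum ▸ hsum.of_norm.hasSum⟩

theorem hasSum_moebiusSeries (hlam : 0 < lam) {w : ℂ} (hw : ‖w‖ < lam) :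
    (Summable fun k => ‖((coeff k (moebiusSeries lam mu) : ℝ) : ℂ) * w ^ k‖) ∧
      HasSum (fun k => ((coeff k (moebiusSeries lam mu) : ℝ) : ℂ) * w ^ k)
        ((mu - w) / (lam - w)) := by
  have hlamC : (lam : ℂ) ≠ 0 := by exact_mod_cast hlam.ne'
  have hsub : (lam : ℂ) - w ≠ 0 := fun h => by
    rw [← sub_eq_zero.1 h, Complex.norm_real, Real.norm_of_nonneg hlam.le] at hw
    exact hw.false
  have hlt : ‖w / lam‖ < 1 := by
    rw [norm_div, Complex.norm_real, Real.norm_of_nonneg hlam.le]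
    exact (div_lt_one hlam).2 hw
  have hterm : ∀ k, ((coeff k (moebiusSeries lam mu) : ℝ) : ℂ) * w ^ k =
      (if k = 0 then 1 else 0) - ((lam - mu) / lam : ℂ) * (w / lam) ^ k := by
    intro k
    rw [moebiusSeries, map_sub, coeff_one, coeff_C_mul, coeff_mk]
    rcases eq_or_ne k 0 with rfl | hk
    · simp
    · simp [hk, div_pow]
      ring
  have h1 : HasSum (fun k : ℕ => if k = 0 then (1 : ℂ) else 0) 1 := hasSum_ite_eq 0 1
  have h2 := (hasSum_geometric_of_norm_lt_one hlt).mul_left ((lam - mu) / lam : ℂ)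
  simp only [hterm]
  constructor
  · refine Summable.of_nonneg_of_le (fun _ => norm_nonneg _) (fun k => norm_sub_le _ _) ?_
    refine Summable.add ?_ ?_
    · exact (hasSum_single 0 fun k hk => by simp [hk]).summable
    · simp only [norm_mul, norm_pow]
      exact (summable_geometric_of_lt_one (norm_nonneg _) hlt).mul_left _
  · have hval : (mu - w) / (lam - w) =
        1 - ((lam - mu) / lam : ℂ) * (1 - w / lam)⁻¹ := by
      rw [one_sub_div hlamC, inv_div]
      field_simp
      ring
    rw [hval]
    exact h1.sub h2

theorem hasSum_birthDeathEigenfun (hlam : 0 < lam) {w : ℂ} (hw : ‖w‖ < lam) (n : ℕ) :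
    (Summable fun k => ‖(birthDeathEigenfun lam mu k n : ℂ) * w ^ k‖) ∧
      HasSum (fun k => (birthDeathEigenfun lam mu k n : ℂ) * w ^ k)
        (((mu - w) / (lam - w)) ^ n) := by
  unfold birthDeathEigenfun
  induction n with
  | zero =>
    have hterm : ∀ k, ((coeff k (1 : PowerSeries ℝ) : ℝ) : ℂ) * w ^ k =
        if k = 0 then 1 else 0 := by
      intro k
      rcases eq_or_ne k 0 with rfl | hk
      · simp
      · simp [coeff_one, hk]
    simp only [pow_zero (moebiusSeries lam mu), hterm, pow_zero ((mu - w) / (lam - w))]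
    exact ⟨(hasSum_single (0 : ℕ) fun k hk => by simp [hk]).summable, hasSum_ite_eq (0 : ℕ) (1 : ℂ)⟩
  | succ n ih =>
    have h := hasSum_moebiusSeries (mu := mu) hlam hw
    simp only [pow_succ]
    exact hasSum_coeff_mul ih.1 ih.2 h.1 h.2

/-- Cauchy's estimate for the coefficients of a convergent power series. -/
theorem norm_coeff_le_of_hasSum {c : ℕ → ℂ} {f : ℂ → ℂ} {ρ R B : ℝ} (hρ : 0 < ρ) (hR : ρ < R)
    (hsum : ∀ w : ℂ, ‖w‖ < R → HasSum (fun k => c k * w ^ k) (f w))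
    (hB : ∀ w : ℂ, ‖w‖ = ρ → ‖f w‖ ≤ B) (k : ℕ) : ‖c k‖ ≤ B * ρ⁻¹ ^ k := by
  have hR0 : 0 < R := hρ.trans hR
  have hser : HasFPowerSeriesOnBall f (FormalMultilinearSeries.ofScalars ℂ c) 0
      (ENNReal.ofReal R) := by
    refine ⟨?_, by simpa using hR0, fun {y} hy => ?_⟩
    · refine ENNReal.le_of_forall_nnreal_lt fun s hs => ?_
      refine FormalMultilinearSeries.le_radius_of_tendsto (l := 0) _ ?_
      have hs' : ‖((s : ℝ) : ℂ)‖ < R := by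
        rw [← ENNReal.ofReal_coe_nnreal] at hs
        have hnorm : ‖((s : ℝ) : ℂ)‖ = s := Complex.norm_of_nonneg s.2
        exact hnorm.trans_lt ((ENNReal.ofReal_lt_ofReal_iff hR0).1 hs)
      have := (hsum _ hs').summable.tendsto_atTop_zero.norm
      simpa [FormalMultilinearSeries.ofScalars_norm] using this
    · have hy' : ‖y‖ < R := by
        simpa [edist_zero_right, ← ofReal_norm, ENNReal.ofReal_lt_ofReal_iff hR0] using hy
      simpa [FormalMultilinearSeries.ofScalars_apply_eq, mul_comm] using hsum y hy'
  lift ρ to NNReal using hρ.le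
  have hd : DifferentiableOn ℂ f (Metric.closedBall 0 ρ) := by
    refine hser.differentiableOn.mono fun w hw => ?_
    have : ‖w‖ < R := (mem_closedBall_zero_iff.1 hw).trans_lt hR
    simpa [edist_zero_right, ← ofReal_norm, ENNReal.ofReal_lt_ofReal_iff hR0] using this
  have heq := hser.hasFPowerSeriesAt.eq_formalMultilinearSeries
    (hd.hasFPowerSeriesOnBall (by exact_mod_cast hρ)).hasFPowerSeriesAt
  have hnorm := norm_cauchyPowerSeries_le f 0 ρ k
  rw [← heq, FormalMultilinearSeries.ofScalars_norm, abs_of_pos hρ] at hnorm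
  refine hnorm.trans (mul_le_mul_of_nonneg_right ?_ (by positivity))
  have hint : ∫ θ in (0 : ℝ)..2 * Real.pi, ‖f (circleMap 0 ρ θ)‖ ≤ 2 * Real.pi * B := by
    have := intervalIntegral.norm_integral_le_of_norm_le_const (a := 0) (b := 2 * Real.pi)
      (C := B) (f := fun θ => ‖f (circleMap 0 ρ θ)‖) fun θ _ => by
        rw [norm_norm]
        exact hB _ (by simp)
    rw [sub_zero, abs_of_pos Real.two_pi_pos] at this
    linarith [le_abs_self (∫ θ in (0 : ℝ)..2 * Real.pi, ‖f (circleMap 0 ρ θ)‖),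
      Real.norm_eq_abs (∫ θ in (0 : ℝ)..2 * Real.pi, ‖f (circleMap 0 ρ θ)‖)]
  rw [inv_mul_le_iff₀ Real.two_pi_pos]
  exact hint

theorem exists_norm_moebius_le (hmu : 0 < mu) (h : mu < lam) {ρ : ℝ} (hρ : 0 < ρ)
    (hρ' : 2 * ρ < lam + mu) :
    ∃ θ : ℝ, 0 ≤ θ ∧ θ < 1 ∧ ∀ w : ℂ, ‖w‖ = ρ → ‖((mu : ℂ) - w) / (lam - w)‖ ≤ θ := by
  set δ := (lam - mu) * (lam + mu - 2 * ρ) with hδ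
  have hδ0 : 0 < δ := mul_pos (by linarith) (by linarith)
  have hs : 0 < lam + ρ := by linarith
  refine ⟨√(1 - δ / (lam + ρ) ^ 2), Real.sqrt_nonneg _, ?_, fun w hw => ?_⟩
  · rw [Real.sqrt_lt' one_pos]
    have : 0 < δ / (lam + ρ) ^ 2 := by positivity
    linarith
  · refine Real.le_sqrt_of_sq_le ?_
    have hre : w.re ≤ ρ := hw ▸ Complex.re_le_norm w
    have h1 : ‖(mu : ℂ) - w‖ ^ 2 = (mu - w.re) ^ 2 + w.im ^ 2 := by
      rw [← Complex.normSq_eq_norm_sq, Complex.normSq_apply]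
      simp
      ring
    have h2 : ‖(lam : ℂ) - w‖ ^ 2 = (lam - w.re) ^ 2 + w.im ^ 2 := by
      rw [← Complex.normSq_eq_norm_sq, Complex.normSq_apply]
      simp
      ring
    have h3 : ‖(lam : ℂ) - w‖ ≤ lam + ρ := by
      refine (norm_sub_le _ _).trans ?_
      rw [hw, Complex.norm_real, Real.norm_of_nonneg (by linarith)]
    have h4 : 0 < ‖(lam : ℂ) - w‖ ^ 2 := by
      rw [h2]
      have : 0 < lam - w.re := by linarith
      positivity
    have h5 : ‖(lam : ℂ) - w‖ ^ 2 ≤ (lam + ρ) ^ 2 := by gcongr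
    have h6 : ‖(mu : ℂ) - w‖ ^ 2 + δ ≤ ‖(lam : ℂ) - w‖ ^ 2 := by
      rw [h1, h2, hδ]
      nlinarith
    rw [norm_div, div_pow, div_le_iff₀ h4]
    have h7 : δ / (lam + ρ) ^ 2 * ‖(lam : ℂ) - w‖ ^ 2 ≤ δ := by
      rw [div_mul_eq_mul_div, div_le_iff₀ (by positivity)]
      gcongr
    linarith

theorem exists_abs_birthDeathEigenfun_le (hmu : 0 < mu) (h : mu < lam) {ρ : ℝ} (hρ : 0 < ρ)
    (hρ' : 2 * ρ < lam + mu) :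
    ∃ θ : ℝ, 0 ≤ θ ∧ θ < 1 ∧
      ∀ k n : ℕ, |birthDeathEigenfun lam mu k n| ≤ θ ^ n * ρ⁻¹ ^ k := by
  obtain ⟨θ, h0, h1, hθ⟩ := exists_norm_moebius_le hmu h hρ hρ'
  refine ⟨θ, h0, h1, fun k n => ?_⟩
  have := norm_coeff_le_of_hasSum (c := fun k => (birthDeathEigenfun lam mu k n : ℂ)) hρ
    (by linarith : ρ < lam)
    (fun w hw => (hasSum_birthDeathEigenfun (mu := mu) (hmu.trans h) hw n).2)
    (B := θ ^ n) (fun w hw => by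
      rw [norm_pow]
      exact pow_le_pow_left₀ (norm_nonneg _) (hθ w hw) n) k
  simpa using this

theorem exists_carreDuChamp_le {φ : ℕ → ℝ} {θ B : ℝ} (hlam : 0 ≤ lam) (hmu : 0 ≤ mu)
    (h0 : 0 ≤ θ) (h1 : θ < 1) (hφ : ∀ n, |φ n| ≤ θ ^ n * B) :
    ∃ K, ∀ n : ℕ, n * lam * (φ (n + 1) - φ n) ^ 2 + n * mu * (φ (n - 1) - φ n) ^ 2 ≤ K := by
  have hB : 0 ≤ B := by simpa using (abs_nonneg _).trans (hφ 0)
  have hθ2 : θ ^ 2 < 1 := by nlinarith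
  obtain ⟨K, hK⟩ := (tendsto_self_mul_const_pow_of_lt_one (sq_nonneg θ) hθ2).bddAbove_range
  have hK' : ∀ m : ℕ, m * (θ ^ 2) ^ m ≤ K := fun m => hK ⟨m, rfl⟩
  have hK0 : 0 ≤ K := by simpa using hK' 0
  refine ⟨(lam + mu) * (4 * B ^ 2) * (K + 1), fun n => ?_⟩
  rcases n with _ | n
  · simp
    positivity
  have hp : θ ^ (n + 1) ≤ θ ^ n := pow_le_pow_of_le_one h0 h1.le (by omega)
  have hp2 : θ ^ (n + 1 + 1) ≤ θ ^ n := pow_le_pow_of_le_one h0 h1.le (by omega)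
  have hn0 := hφ n
  have hn1 := (hφ (n + 1)).trans (mul_le_mul_of_nonneg_right hp hB)
  have hn2 := (hφ (n + 1 + 1)).trans (mul_le_mul_of_nonneg_right hp2 hB)
  have hdiff : ∀ a b : ℝ, |a| ≤ θ ^ n * B → |b| ≤ θ ^ n * B →
      (a - b) ^ 2 ≤ 4 * B ^ 2 * (θ ^ 2) ^ n := fun a b ha hb => by
    have hab : |a - b| ≤ 2 * (θ ^ n * B) := (abs_sub _ _).trans (by linarith)
    calc (a - b) ^ 2 = |a - b| ^ 2 := (sq_abs _).symm
      _ ≤ (2 * (θ ^ n * B)) ^ 2 := by gcongr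
      _ = _ := by ring
  have hu := hdiff _ _ hn2 hn1
  have hd := hdiff _ _ hn0 hn1
  have hpow : (θ ^ 2) ^ n ≤ 1 := pow_le_one₀ (sq_nonneg _) hθ2.le
  rw [Nat.add_sub_cancel]
  calc ((n + 1 : ℕ) : ℝ) * lam * (φ (n + 1 + 1) - φ (n + 1)) ^ 2 +
        ((n + 1 : ℕ) : ℝ) * mu * (φ n - φ (n + 1)) ^ 2
      ≤ ((n + 1 : ℕ) : ℝ) * lam * (4 * B ^ 2 * (θ ^ 2) ^ n) +
        ((n + 1 : ℕ) : ℝ) * mu * (4 * B ^ 2 * (θ ^ 2) ^ n) := by gcongr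
    _ = (lam + mu) * (4 * B ^ 2) * (n * (θ ^ 2) ^ n + (θ ^ 2) ^ n) := by push_cast; ring
    _ ≤ _ := by
      have := hK' n
      gcongr

end Eigenfunction

section GeneratingFunction

theorem tendsto_zero_and_shift_of_tendsto_tsum_mul_pow {b : ℕ → ℕ → ℝ} {B q : ℝ}
    (hq : 0 < q) (hq1 : q < 1)
    (hb : ∀ t j, |b t j| ≤ B)
    (hG : ∀ z, 0 < z → z ≤ q → Tendsto (fun t => ∑' j, b t j * z ^ j) atTop (𝓝 0)) :
    Tendsto (fun t => b t 0) atTop (𝓝 0) ∧ ∀ z, 0 < z → z ≤ q →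
      Tendsto (fun t => ∑' j, b t (j + 1) * z ^ j) atTop (𝓝 0) := by
  have hB : 0 ≤ B := (abs_nonneg _).trans (hb 0 0)
  have hbound : ∀ {z : ℝ}, 0 < z → ∀ t j, ‖b t j * z ^ j‖ ≤ B * z ^ j := fun hz t j => by
    rw [Real.norm_eq_abs, abs_mul, abs_of_pos (pow_pos hz j)]
    exact mul_le_mul_of_nonneg_right (hb t j) (pow_pos hz j).le
  have hsum : ∀ {z : ℝ}, 0 < z → z ≤ q → ∀ t, Summable fun j => b t j * z ^ j :=
    fun hz hzq t => Summable.of_norm_bounded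
      ((summable_geometric_of_lt_one hz.le (hzq.trans_lt hq1)).mul_left B) (hbound hz t)
  have hsplit : ∀ {z : ℝ}, 0 < z → z ≤ q → ∀ t,
      ∑' j, b t j * z ^ j = b t 0 + z * ∑' j, b t (j + 1) * z ^ j := fun hz hzq t => by
    rw [(hsum hz hzq t).tsum_eq_zero_add, ← tsum_mul_left]
    simp only [pow_zero, mul_one, pow_succ]
    congr 1
    exact tsum_congr fun j => by ring
  have hzero : Tendsto (fun t => b t 0) atTop (𝓝 0) := by
    rw [Metric.tendsto_atTop]
    intro ε hε
    set D := B * (1 - q)⁻¹ + 1 with hD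
    have hq' : 0 < 1 - q := by linarith
    have hD0 : 0 < D := by positivity
    set z := min q (ε / (2 * D)) with hz
    have hz0 : 0 < z := lt_min hq (by positivity)
    have hzq : z ≤ q := min_le_left _ _
    obtain ⟨N, hN⟩ := Metric.tendsto_atTop.1 (hG z hz0 hzq) (ε / 2) (by positivity)
    refine ⟨N, fun t ht => ?_⟩
    have h1 := hN t ht
    rw [Real.dist_0_eq_abs, hsplit hz0 hzq] at h1
    rw [Real.dist_0_eq_abs]
    have h2 : ‖∑' j, b t (j + 1) * z ^ j‖ ≤ B * (1 - z)⁻¹ :=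
      tsum_of_norm_bounded ((hasSum_geometric_of_lt_one hz0.le (hzq.trans_lt hq1)).mul_left B)
        fun j => by
          rw [Real.norm_eq_abs, abs_mul, abs_of_pos (pow_pos hz0 j)]
          exact mul_le_mul_of_nonneg_right (hb t _) (pow_pos hz0 j).le
    have h3 : B * (1 - z)⁻¹ ≤ D := by
      have : (1 - z)⁻¹ ≤ (1 - q)⁻¹ := by gcongr
      have := mul_le_mul_of_nonneg_left this hB
      linarith
    have h4 : |z * ∑' j, b t (j + 1) * z ^ j| ≤ ε / 2 := by
      rw [abs_mul, abs_of_pos hz0]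
      calc z * |∑' j, b t (j + 1) * z ^ j| ≤ ε / (2 * D) * D :=
            mul_le_mul (min_le_right _ _) (h2.trans h3) (abs_nonneg _) (by positivity)
        _ = ε / 2 := by field_simp
    have := abs_sub (b t 0 + z * ∑' j, b t (j + 1) * z ^ j) (z * ∑' j, b t (j + 1) * z ^ j)
    rw [add_sub_cancel_right] at this
    linarith
  refine ⟨hzero, fun z hz hzq => ?_⟩
  have := ((hG z hz hzq).sub hzero).const_mul z⁻¹
  simp only [hsplit hz hzq, add_sub_cancel_left, inv_mul_cancel_left₀ hz.ne', sub_zero,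
    mul_zero] at this
  exact this

theorem tendsto_zero_of_tendsto_tsum_mul_pow {b : ℕ → ℕ → ℝ} {B q : ℝ} (hq : 0 < q) (hq1 : q < 1)
    (hb : ∀ t j, |b t j| ≤ B)
    (hG : ∀ z, 0 < z → z ≤ q → Tendsto (fun t => ∑' j, b t j * z ^ j) atTop (𝓝 0)) (j : ℕ) :
    Tendsto (fun t => b t j) atTop (𝓝 0) := by
  have h := tendsto_zero_and_shift_of_tendsto_tsum_mul_pow hq hq1 hb hG
  induction j generalizing b with
  | zero => exact h.1
  | succ j ih =>
    have hb' : ∀ t j, |b t (j + 1)| ≤ B := fun t j => hb t _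
    exact ih hb' h.2 (tendsto_zero_and_shift_of_tendsto_tsum_mul_pow hq hq1 hb' h.2)

variable {lam1 lam2 mu2 : ℝ}

theorem hasSum_inDegProb_mul_pow (t : ℕ) (z : ℝ) :
    HasSum (fun j => inDegProb lam1 lam2 mu2 t j * z ^ j)
      (chainExp lam1 lam2 mu2 t (entryAvg fun n => z ^ n)) := by
  have h := hasSum_chainExp (lam1 := lam1) (lam2 := lam2) (mu2 := mu2) t
    (hasSum_entryAvg (F := fun j n => z ^ j * if n = j then 1 else 0) (f := fun n => z ^ n)
      fun n => by
        simpa using hasSum_single (f := fun j => z ^ j * if n = j then (1 : ℝ) else 0) n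
          fun j hj => by simp [hj.symm])
  convert h using 2 with j
  rw [inDegProb_eq_chainExp, mul_comm, ← chainExp_const_mul]
  congr 1
  funext x
  rw [entryAvg_const_mul]

theorem abs_chainExp_entryAvg_le (hlam1 : 0 < lam1) (hlam2 : 0 ≤ lam2) (hmu2 : 0 ≤ mu2)
    {φ : ℕ → ℝ} {M : ℝ} (hφ : ∀ n, |φ n| ≤ M) (t : ℕ) :
    |chainExp lam1 lam2 mu2 t (entryAvg φ)| ≤ M := by
  refine abs_le.2 ⟨?_, ?_⟩
  · refine (chainExp_const hlam1 hlam2 hmu2 t (-M)).symm.trans_le ?_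
    exact chainExp_mono hlam1.le hlam2 hmu2 t fun x hx => (abs_le.1 (abs_entryAvg_le φ hφ hx.1)).1
  · refine le_of_le_of_eq ?_ (chainExp_const hlam1 hlam2 hmu2 t M)
    exact chainExp_mono hlam1.le hlam2 hmu2 t fun x hx => (abs_le.1 (abs_entryAvg_le φ hφ hx.1)).2

theorem abs_inDegProb_le_one (hlam1 : 0 < lam1) (hlam2 : 0 ≤ lam2) (hmu2 : 0 ≤ mu2) (t j : ℕ) :
    |inDegProb lam1 lam2 mu2 t j| ≤ 1 := by
  rw [inDegProb_eq_chainExp]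
  exact abs_chainExp_entryAvg_le hlam1 hlam2 hmu2 (fun n => by split_ifs <;> simp) t

theorem tendsto_tsum_inDegProb_mul_pow (hlam1 : 0 < lam1) (hmu2 : 0 < mu2) (h : mu2 < lam2)
    {w : ℝ} (hw0 : 0 ≤ w) (hw : w ≤ mu2) :
    Tendsto (fun t => ∑' j, inDegProb lam1 lam2 mu2 t j * ((mu2 - w) / (lam2 - w)) ^ j) atTop
      (𝓝 (∑' k : ℕ, lam1 / ((lam2 - mu2) * k + lam1) *
        (PowerSeries.coeff k (moebiusSeries lam2 mu2) * w ^ k))) := by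
  have hlam2 : 0 < lam2 := hmu2.trans h
  set ρ := (lam2 + 3 * mu2) / 4 with hρdef
  have hρ : 0 < ρ := by linarith
  obtain ⟨θ, hθ0, hθ1, hθ⟩ := exists_abs_birthDeathEigenfun_le hmu2 h hρ
    (by linarith : 2 * ρ < lam2 + mu2)
  have hM : ∀ k n, |birthDeathEigenfun lam2 mu2 k n| ≤ ρ⁻¹ ^ k := fun k n =>
    (hθ k n).trans (mul_le_of_le_one_left (by positivity) (pow_le_one₀ hθ0 hθ1.le))
  have hser : ∀ n, HasSum (fun k => w ^ k * birthDeathEigenfun lam2 mu2 k n)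
      (((mu2 - w) / (lam2 - w)) ^ n) := fun n => by
    have hwn : ‖(w : ℂ)‖ < lam2 := by
      rw [Complex.norm_of_nonneg hw0]
      linarith
    have := (hasSum_birthDeathEigenfun (mu := mu2) hlam2 hwn n).2
    rw [← Complex.hasSum_ofReal]
    push_cast
    simpa only [mul_comm] using this
  have hexp : ∀ t, ∑' j, inDegProb lam1 lam2 mu2 t j * ((mu2 - w) / (lam2 - w)) ^ j =
      ∑' k, w ^ k * chainExp lam1 lam2 mu2 t (entryAvg (birthDeathEigenfun lam2 mu2 k)) := by
    intro t
    rw [(hasSum_inDegProb_mul_pow t _).tsum_eq, ← (hasSum_chainExp t (hasSum_entryAvg hser)).tsum_eq]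
    refine tsum_congr fun k => ?_
    rw [← chainExp_const_mul]
    congr 1
    funext x
    rw [entryAvg_const_mul]
  simp only [hexp]
  have hwρ : w * ρ⁻¹ < 1 := by
    rw [← div_eq_mul_inv, div_lt_one hρ]
    linarith
  refine tendsto_tsum_of_dominated_convergence (bound := fun k => (w * ρ⁻¹) ^ k)
    (summable_geometric_of_lt_one (by positivity) hwρ) (fun k => ?_) (.of_forall fun t k => ?_)
  · obtain ⟨K, hK⟩ := exists_carreDuChamp_le hlam2.le hmu2.le hθ0 hθ1 (hθ k)
    have := (tendsto_chainExp_entryAvg hlam1 hlam2.le hmu2.le (κ := (lam2 - mu2) * k)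
      (mul_nonneg (by linarith) k.cast_nonneg) (hM k)
      (birthDeathEigenfun_eigen hlam2.ne' k) hK).const_mul (w ^ k)
    convert this using 2
    rw [birthDeathEigenfun, pow_one]
    ring
  · rw [Real.norm_eq_abs, abs_mul, abs_of_nonneg (pow_nonneg hw0 k), mul_pow]
    exact mul_le_mul_of_nonneg_left (abs_chainExp_entryAvg_le hlam1 hlam2.le hmu2.le (hM k) t)
      (pow_nonneg hw0 k)

end GeneratingFunction

section Mixture

variable {α : ℝ}

theorem intervalIntegrable_mul_rpow (hα : 0 < α) (c : ℝ) :
    IntervalIntegrable (fun u : ℝ => α * u ^ (α - 1) * c) volume 0 1 :=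
  ((intervalIntegral.intervalIntegrable_rpow' (by linarith)).const_mul α).mul_const c

theorem integral_mul_rpow_mul_pow (hα : 0 < α) (c : ℝ) (k : ℕ) :
    ∫ u in (0 : ℝ)..1, α * u ^ (α - 1) * (c * u ^ k) = α / (k + α) * c := by
  have h : ∀ u ∈ Set.uIoc (0 : ℝ) 1, α * u ^ (α - 1) * (c * u ^ k) =
      α * c * u ^ (α - 1 + k) := fun u hu => by
    rw [Set.uIoc_of_le zero_le_one] at hu
    rw [Real.rpow_add hu.1, Real.rpow_natCast]
    ring
  rw [intervalIntegral.integral_congr_ae (.of_forall h), intervalIntegral.integral_const_mul,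
    integral_rpow (.inl (by have := k.cast_nonneg (α := ℝ); linarith))]
  have h1 : α - 1 + k + 1 = k + α := by ring
  have h2 : (0 : ℝ) < k + α := by positivity
  rw [h1, Real.one_rpow, Real.zero_rpow h2.ne']
  ring

theorem hasSum_integral_mul_rpow (hα : 0 < α) {f : ℕ → ℝ → ℝ} {F : ℝ → ℝ} {C : ℕ → ℝ}
    (hf : ∀ k, Measurable (f k)) (hC : Summable C)
    (hbound : ∀ k, ∀ u ∈ Set.Ioc (0 : ℝ) 1, |f k u| ≤ C k)
    (hsum : ∀ u ∈ Set.Ioc (0 : ℝ) 1, HasSum (fun k => f k u) (F u)) :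
    HasSum (fun k => ∫ u in (0 : ℝ)..1, α * u ^ (α - 1) * f k u)
      (∫ u in (0 : ℝ)..1, α * u ^ (α - 1) * F u) := by
  refine intervalIntegral.hasSum_integral_of_dominated_convergence
    (fun k u => α * u ^ (α - 1) * C k) (fun k => ?_) (fun k => .of_forall fun u hu => ?_)
    (.of_forall fun u _ => hC.mul_left _) ?_ (.of_forall fun u hu => ?_)
  · exact (((measurable_id.pow_const _).const_mul α).mul (hf k)).aestronglyMeasurable
  · rw [Set.uIoc_of_le zero_le_one] at hu
    have : 0 ≤ α * u ^ (α - 1) := mul_nonneg hα.le (Real.rpow_nonneg hu.1.le _)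
    rw [Real.norm_eq_abs, abs_mul, abs_of_nonneg this]
    exact mul_le_mul_of_nonneg_left (hbound k u hu) this
  · simp only [tsum_mul_left]
    exact intervalIntegrable_mul_rpow hα _
  · rw [Set.uIoc_of_le zero_le_one] at hu
    exact (hsum u hu).mul_left _

theorem abs_integral_mul_rpow_le (hα : 0 < α) {f : ℝ → ℝ}
    (hf : ∀ u ∈ Set.Ioc (0 : ℝ) 1, |f u| ≤ 1) :
    |∫ u in (0 : ℝ)..1, α * u ^ (α - 1) * f u| ≤ 1 := by
  have h := integral_mul_rpow_mul_pow hα 1 0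
  simp only [pow_zero, mul_one, Nat.cast_zero, zero_add, div_self hα.ne'] at h
  have hint := intervalIntegrable_mul_rpow hα 1
  simp only [mul_one] at hint
  rw [← Real.norm_eq_abs]
  refine le_of_le_of_eq (intervalIntegral.norm_integral_le_of_norm_le zero_le_one
    (.of_forall fun u hu => ?_) hint) h
  have : 0 ≤ α * u ^ (α - 1) := mul_nonneg hα.le (Real.rpow_nonneg hu.1.le _)
  rw [Real.norm_eq_abs, abs_mul, abs_of_nonneg this]
  exact mul_le_of_le_one_right this (hf u hu)

/-- The Taylor coefficients in `z` of `(mu - u * w) / (lam - u * w)` with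
`w = (mu - lam * z) / (1 - z)`. -/
noncomputable def mixtureKernel (lam mu : ℝ) : ℕ → ℝ → ℝ
  | 0 => fun u => mu * (1 - u) / (lam - mu * u)
  | j + 1 => fun u => (lam - mu) ^ 2 * u * (lam * (1 - u)) ^ j / (lam - mu * u) ^ (j + 2)

variable {lam mu : ℝ}

theorem measurable_mixtureKernel (j : ℕ) : Measurable (mixtureKernel lam mu j) := by
  cases j <;> unfold mixtureKernel <;> fun_prop

theorem abs_mixtureKernel_le_one (hmu : 0 < mu) (h : mu < lam) (j : ℕ) {u : ℝ}
    (hu : u ∈ Set.Ioc (0 : ℝ) 1) : |mixtureKernel lam mu j u| ≤ 1 := by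
  obtain ⟨hu0, hu1⟩ := hu
  have hr : 0 < lam - mu := by linarith
  have hlam : 0 < lam := by linarith
  have hden' : lam - mu ≤ lam - mu * u := by nlinarith
  have hden : 0 < lam - mu * u := by linarith
  have hv : 0 ≤ 1 - u := by linarith
  cases j with
  | zero =>
    rw [mixtureKernel, abs_of_nonneg (by positivity), div_le_one hden]
    nlinarith
  | succ j =>
    rw [mixtureKernel, abs_of_nonneg (by positivity), div_le_one (by positivity), pow_add,
      mul_comm]
    refine mul_le_mul (pow_le_pow_left₀ (by positivity) (by nlinarith) j) ?_ (by positivity)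
      (by positivity)
    exact (mul_le_of_le_one_right (by positivity) hu1).trans (by gcongr)

theorem hasSum_mixtureKernel_mul_pow (hmu : 0 < mu) (h : mu < lam) {u z : ℝ}
    (hu : u ∈ Set.Ioc (0 : ℝ) 1) (hz0 : 0 < z) (hz1 : z < 1) :
    HasSum (fun j => mixtureKernel lam mu j u * z ^ j)
      ((mu - (mu - lam * z) / (1 - z) * u) / (lam - (mu - lam * z) / (1 - z) * u)) := by
  obtain ⟨hu0, hu1⟩ := hu
  have hr : 0 < lam - mu := by linarith
  have hlam : 0 < lam := by linarith
  have hden : 0 < lam - mu * u := by nlinarith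
  have hv : 0 ≤ 1 - u := by linarith
  have hx : lam * (1 - u) / (lam - mu * u) ≤ 1 := (div_le_one hden).2 (by nlinarith)
  have hx0 : 0 ≤ lam * (1 - u) / (lam - mu * u) := by positivity
  have hlt : lam * (1 - u) / (lam - mu * u) * z < 1 := by nlinarith
  have hgeom := (hasSum_geometric_of_lt_one (mul_nonneg hx0 hz0.le) hlt).mul_left
    ((lam - mu) ^ 2 * u * z / (lam - mu * u) ^ 2)
  have hterm : ∀ j, mixtureKernel lam mu (j + 1) u * z ^ (j + 1) =
      (lam - mu) ^ 2 * u * z / (lam - mu * u) ^ 2 *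
        (lam * (1 - u) / (lam - mu * u) * z) ^ j := fun j => by
    simp only [mixtureKernel, mul_pow, pow_add, div_eq_mul_inv, mul_inv, pow_one]
    ring
  have hval : (mu - (mu - lam * z) / (1 - z) * u) / (lam - (mu - lam * z) / (1 - z) * u) -
      mixtureKernel lam mu 0 u * z ^ 0 =
      (lam - mu) ^ 2 * u * z / (lam - mu * u) ^ 2 *
        (1 - lam * (1 - u) / (lam - mu * u) * z)⁻¹ := by
    have h1 : 0 < 1 - lam * (1 - u) / (lam - mu * u) * z := by linarith
    have h3 : 1 - z ≠ 0 := by linarith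
    have h4 : lam - (mu - lam * z) / (1 - z) * u =
        ((lam - mu * u) - lam * (1 - u) * z) / (1 - z) := by field_simp; ring
    have h5 : mu - (mu - lam * z) / (1 - z) * u =
        (mu * (1 - u) - (mu - lam * u) * z) / (1 - z) := by field_simp; ring
    rw [h4, h5, div_div_div_cancel_right₀ h3, pow_zero, mul_one]
    simp only [mixtureKernel]
    obtain ⟨d, hd⟩ : ∃ d, d = lam - mu * u := ⟨_, rfl⟩
    rw [← hd] at hden h1 ⊢
    have h6 : 1 - lam * (1 - u) / d * z = (d - lam * (1 - u) * z) / d := by field_simp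
    have h2 : d - lam * (1 - u) * z ≠ 0 := fun h0 => by simp [h6, h0] at h1
    obtain ⟨e, he⟩ : ∃ e, e = d - lam * (1 - u) * z := ⟨_, rfl⟩
    rw [h6, ← he]
    rw [← he] at h2
    field_simp
    rw [he, hd]
    ring
  refine (hasSum_nat_add_iff' 1).1 ?_
  simp only [hterm, Finset.sum_range_one]
  rw [hval]
  exact hgeom

theorem hasSum_integral_mixtureKernel_mul_pow (hα : 0 < α) (hmu : 0 < mu) (h : mu < lam)
    {z : ℝ} (hz0 : 0 < z) (hz1 : z ≤ mu / lam) :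
    HasSum (fun j => (∫ u in (0 : ℝ)..1, α * u ^ (α - 1) * mixtureKernel lam mu j u) * z ^ j)
      (∑' k : ℕ, α / (k + α) *
        (PowerSeries.coeff k (moebiusSeries lam mu) * ((mu - lam * z) / (1 - z)) ^ k)) := by
  have hlam : 0 < lam := hmu.trans h
  have hq1 : mu / lam < 1 := (div_lt_one hlam).2 h
  have hz : 0 < 1 - z := by linarith
  set w := (mu - lam * z) / (1 - z) with hw
  have hw0 : 0 ≤ w := by
    have := (le_div_iff₀ hlam).1 hz1
    exact div_nonneg (by linarith) hz.le
  have hwlam : w < lam := by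
    rw [hw, div_lt_iff₀ hz]
    linarith
  have hcomplex : ∀ v : ℝ, 0 ≤ v → v < lam → ‖(v : ℂ)‖ < lam := fun v hv hvl => by
    rwa [Complex.norm_of_nonneg hv]
  have hsummable : Summable fun k => |PowerSeries.coeff k (moebiusSeries lam mu) * w ^ k| := by
    have := (hasSum_moebiusSeries (mu := mu) hlam (hcomplex w hw0 hwlam)).1
    simpa [abs_mul] using this
  have h1 := hasSum_integral_mul_rpow hα
    (f := fun k u => PowerSeries.coeff k (moebiusSeries lam mu) * w ^ k * u ^ k)
    (F := fun u => (mu - w * u) / (lam - w * u)) (fun k => by fun_prop) hsummable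
    (fun k u hu => by
      rw [abs_mul, abs_of_nonneg (pow_nonneg hu.1.le k)]
      exact mul_le_of_le_one_right (abs_nonneg _) (pow_le_one₀ hu.1.le hu.2))
    (fun u hu => by
      have hwu : w * u ≤ w := mul_le_of_le_one_right hw0 hu.2
      have := (hasSum_moebiusSeries (mu := mu) hlam
        (hcomplex (w * u) (mul_nonneg hw0 hu.1.le) (by linarith))).2
      rw [← Complex.hasSum_ofReal]
      push_cast at this ⊢
      simpa only [mul_pow, mul_assoc] using this)
  simp only [integral_mul_rpow_mul_pow hα] at h1
  have h2 := hasSum_integral_mul_rpow hα (f := fun j u => mixtureKernel lam mu j u * z ^ j)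
    (F := fun u => (mu - w * u) / (lam - w * u))
    (fun j => (measurable_mixtureKernel j).mul_const _)
    (summable_geometric_of_lt_one hz0.le (hz1.trans_lt hq1))
    (fun j u hu => by
      rw [abs_mul, abs_of_pos (pow_pos hz0 j)]
      exact mul_le_of_le_one_left (pow_pos hz0 j).le (abs_mixtureKernel_le_one hmu h j hu))
    (fun u hu => hasSum_mixtureKernel_mul_pow hmu h hu hz0 (hz1.trans_lt hq1))
  rw [h1.tsum_eq]
  simpa only [← mul_assoc, intervalIntegral.integral_mul_const] using h2

end Mixture

section SpecialFunctions

theorem betaFn_comm (a b : ℝ) : betaFn a b = betaFn b a := by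
  have := intervalIntegral.integral_comp_sub_left (a := 0) (b := 1)
    (fun s : ℝ => s ^ (a - 1) * (1 - s) ^ (b - 1)) 1
  rw [sub_self, sub_zero] at this
  rw [betaFn, ← this, betaFn]
  refine intervalIntegral.integral_congr fun s _ => ?_
  simp only [sub_sub_cancel]
  exact mul_comm _ _

theorem betaFn_pos {a b : ℝ} (ha : 0 < a) (hb : 1 ≤ b) : 0 < betaFn a b := by
  refine intervalIntegral.intervalIntegral_pos_of_pos_on ?_ (fun s hs => ?_) one_pos
  · refine (intervalIntegral.intervalIntegrable_rpow' (by linarith)).mul_continuousOn ?_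
    exact ((continuous_const.sub continuous_id).rpow_const fun _ =>
      .inr (by linarith)).continuousOn
  · exact mul_pos (Real.rpow_pos_of_pos hs.1 _) (Real.rpow_pos_of_pos (by linarith [hs.2]) _)

theorem betaFn_mul_gauss2F1 {a b c z : ℝ} (hb : 0 < b) (hc : 1 ≤ c) :
    betaFn c b * gauss2F1 a b (c + b) z =
      ∫ s in (0 : ℝ)..1, s ^ (b - 1) * (1 - s) ^ (c - 1) * (1 - s * z) ^ (-a) := by
  rw [gauss2F1, add_sub_cancel_right, betaFn_comm c b, ← mul_assoc,
    mul_inv_cancel₀ (betaFn_pos hb hc).ne', one_mul]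

variable {lam1 lam mu : ℝ}

theorem integral_mixtureKernel_zero (hlam1 : 0 < lam1) (hmu : 0 < mu) (h : mu < lam) :
    ∫ u in (0 : ℝ)..1, lam1 / (lam - mu) * u ^ (lam1 / (lam - mu) - 1) * mixtureKernel lam mu 0 u =
      mu * lam1 / (lam * (lam - mu)) * betaFn 2 (lam1 / (lam - mu)) *
        gauss2F1 1 (lam1 / (lam - mu)) (2 + lam1 / (lam - mu)) (mu / lam) := by
  have hr : 0 < lam - mu := sub_pos.2 h
  have hlam : 0 < lam := hmu.trans h
  rw [mul_assoc, betaFn_mul_gauss2F1 (div_pos hlam1 hr) one_le_two,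
    ← intervalIntegral.integral_const_mul]
  refine intervalIntegral.integral_congr fun u hu => ?_
  rw [Set.uIcc_of_le zero_le_one] at hu
  have hden : 0 < lam - mu * u := by nlinarith [hu.2]
  have hden' : 1 - u * (mu / lam) = (lam - mu * u) / lam := by field_simp
  have h2 : (2 : ℝ) - 1 = 1 := by norm_num
  simp only [mixtureKernel]
  rw [h2, Real.rpow_one, Real.rpow_neg_one, hden']
  generalize u ^ (lam1 / (lam - mu) - 1) = y
  generalize lam - mu * u = d at *
  field_simp

theorem integral_mixtureKernel_succ (hlam1 : 0 < lam1) (hmu : 0 < mu) (h : mu < lam) (j : ℕ) :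
    ∫ u in (0 : ℝ)..1, lam1 / (lam - mu) * u ^ (lam1 / (lam - mu) - 1) *
        mixtureKernel lam mu (j + 1) u =
      lam1 * (lam - mu) / lam ^ 2 * betaFn (j + 1 : ℕ) (1 + lam1 / (lam - mu)) *
        gauss2F1 ((j + 1 : ℕ) + 1) (1 + lam1 / (lam - mu))
          ((j + 1 : ℕ) + 1 + lam1 / (lam - mu)) (mu / lam) := by
  have hr : 0 < lam - mu := sub_pos.2 h
  have hlam : 0 < lam := hmu.trans h
  have hα : 0 < lam1 / (lam - mu) := div_pos hlam1 hr
  rw [mul_assoc, add_assoc ((j + 1 : ℕ) : ℝ) 1 (lam1 / (lam - mu)),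
    betaFn_mul_gauss2F1 (by linarith) (by push_cast; linarith [j.cast_nonneg (α := ℝ)]),
    ← intervalIntegral.integral_const_mul]
  refine intervalIntegral.integral_congr_ae (.of_forall fun u hu => ?_)
  rw [Set.uIoc_of_le zero_le_one] at hu
  have hden : 0 < lam - mu * u := by nlinarith [hu.2]
  have hden' : 1 - u * (mu / lam) = (lam - mu * u) / lam := by field_simp
  have h1 : ((j + 1 : ℕ) : ℝ) - 1 = (j : ℕ) := by push_cast; ring
  have h2 : -(((j + 1 : ℕ) : ℝ) + 1) = -((j + 2 : ℕ) : ℝ) := by push_cast; ring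
  have h3 : 1 + lam1 / (lam - mu) - 1 = (lam1 / (lam - mu) - 1) + 1 := by ring
  simp only [mixtureKernel]
  rw [h1, h2, h3, Real.rpow_natCast, Real.rpow_neg (by rw [hden']; positivity),
    Real.rpow_natCast, Real.rpow_add_one hu.1.ne', hden']
  generalize u ^ (lam1 / (lam - mu) - 1) = y
  generalize lam - mu * u = d at *
  rw [div_pow, mul_pow, inv_div]
  field_simp
  ring

end SpecialFunctions

theorem tendsto_inDegProb {lam1 lam2 mu2 : ℝ} (hlam1 : 0 < lam1) (hmu2 : 0 < mu2)
    (h : mu2 < lam2) (j : ℕ) :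
    Tendsto (fun t => inDegProb lam1 lam2 mu2 t j) atTop
      (𝓝 (∫ u in (0 : ℝ)..1, lam1 / (lam2 - mu2) * u ^ (lam1 / (lam2 - mu2) - 1) *
        mixtureKernel lam2 mu2 j u)) := by
  have hr : 0 < lam2 - mu2 := sub_pos.2 h
  have hlam2 : 0 < lam2 := hmu2.trans h
  have hα : 0 < lam1 / (lam2 - mu2) := div_pos hlam1 hr
  have hq1 : mu2 / lam2 < 1 := (div_lt_one hlam2).2 h
  set p : ℕ → ℝ := fun j => ∫ u in (0 : ℝ)..1, lam1 / (lam2 - mu2) *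
    u ^ (lam1 / (lam2 - mu2) - 1) * mixtureKernel lam2 mu2 j u with hp
  have hp1 : ∀ j, |p j| ≤ 1 := fun j =>
    abs_integral_mul_rpow_le hα fun u hu => abs_mixtureKernel_le_one hmu2 h j hu
  refine tendsto_sub_nhds_zero_iff.1 (tendsto_zero_of_tendsto_tsum_mul_pow
    (b := fun t j => inDegProb lam1 lam2 mu2 t j - p j) (B := 1 + 1) (div_pos hmu2 hlam2) hq1
    (fun t j => (abs_sub _ _).trans
      (add_le_add (abs_inDegProb_le_one hlam1 hlam2.le hmu2.le t j) (hp1 j)))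
    (fun z hz0 hzq => ?_) j)
  have hz : 0 < 1 - z := by linarith
  have hw0 : 0 ≤ (mu2 - lam2 * z) / (1 - z) := by
    have := (le_div_iff₀ hlam2).1 hzq
    exact div_nonneg (by linarith) hz.le
  have hw : (mu2 - lam2 * z) / (1 - z) ≤ mu2 := by
    rw [div_le_iff₀ hz]
    nlinarith
  have hzw : (mu2 - (mu2 - lam2 * z) / (1 - z)) / (lam2 - (mu2 - lam2 * z) / (1 - z)) = z := by
    have h1 : mu2 - (mu2 - lam2 * z) / (1 - z) = (lam2 - mu2) * z / (1 - z) := by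
      field_simp
      ring
    have h2 : lam2 - (mu2 - lam2 * z) / (1 - z) = (lam2 - mu2) / (1 - z) := by
      field_simp
      ring
    rw [h1, h2, div_div_div_cancel_right₀ hz.ne', mul_div_cancel_left₀ _ hr.ne']
  have hlim := tendsto_tsum_inDegProb_mul_pow hlam1 hmu2 h hw0 hw
  have hpz := hasSum_integral_mixtureKernel_mul_pow hα hmu2 h hz0 hzq
  have hcoef : ∀ k : ℕ, lam1 / (lam2 - mu2) / (k + lam1 / (lam2 - mu2)) =
      lam1 / ((lam2 - mu2) * k + lam1) := fun k => by
    have : (0 : ℝ) < (lam2 - mu2) * k + lam1 := by positivity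
    have h' : (k : ℝ) + lam1 / (lam2 - mu2) = ((lam2 - mu2) * k + lam1) / (lam2 - mu2) := by
      field_simp
    rw [h', div_div_div_cancel_right₀ hr.ne']
  simp only [hcoef] at hpz
  rw [hzw, ← hpz.tsum_eq] at hlim
  have := hlim.sub_const (∑' j, p j * z ^ j)
  rw [sub_self] at this
  refine this.congr fun t => ?_
  rw [← (hasSum_inDegProb_mul_pow t z).summable.tsum_sub hpz.summable]
  exact tsum_congr fun j => (sub_mul _ _ _).symm

/-- Supercritical regime: if `μ₂ > 0` and `λ₂ > μ₂` then for every `j` the limit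
`p_j = lim_t P(d(V_t) = j)` exists, with
`p_0 = (μ₂λ₁/(λ₂(λ₂-μ₂))) B(2, λ₁/(λ₂-μ₂)) ₂F₁(1, λ₁/(λ₂-μ₂), 2+λ₁/(λ₂-μ₂), μ₂/λ₂)` and,
for `j ≥ 1`,
`p_j = (λ₁(λ₂-μ₂)/λ₂²) B(j, 1+λ₁/(λ₂-μ₂)) ₂F₁(j+1, 1+λ₁/(λ₂-μ₂), j+1+λ₁/(λ₂-μ₂), μ₂/λ₂)`. -/
theorem limit_in_degree_distribution_supercritical
    (lam1 lam2 mu2 : ℝ) (hlam1 : 0 < lam1) (hmu2 : 0 < mu2) (h : mu2 < lam2) :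
    Tendsto (fun t => inDegProb lam1 lam2 mu2 t 0) atTop
      (𝓝 (mu2 * lam1 / (lam2 * (lam2 - mu2)) * betaFn 2 (lam1 / (lam2 - mu2)) *
        gauss2F1 1 (lam1 / (lam2 - mu2)) (2 + lam1 / (lam2 - mu2)) (mu2 / lam2))) ∧
    ∀ j : ℕ, 1 ≤ j →
      Tendsto (fun t => inDegProb lam1 lam2 mu2 t j) atTop
        (𝓝 (lam1 * (lam2 - mu2) / lam2 ^ 2 * betaFn j (1 + lam1 / (lam2 - mu2)) *
          gauss2F1 (j + 1) (1 + lam1 / (lam2 - mu2)) (j + 1 + lam1 / (lam2 - mu2))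
            (mu2 / lam2))) := by
  refine ⟨?_, fun j hj => ?_⟩
  · rw [← integral_mixtureKernel_zero hlam1 hmu2 h]
    exact tendsto_inDegProb hlam1 hmu2 h 0
  · obtain ⟨j, rfl⟩ := Nat.exists_eq_add_of_le' hj
    rw [← integral_mixtureKernel_succ hlam1 hmu2 h]
    exact tendsto_inDegProb hlam1 hmu2 h (j + 1)
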